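/- arXiv:2001.03577 — 4 statements merged into one kernel-verified Lean document; each statement's English description precedes it below -/
import Mathlib

section
/- Theorem 2 (converse under uncoded placement). Let F be a finite field, K ≥ 1, N ≥ 1, B ≥ 1 integers, and m a natural number with m ≤ N·B. Suppose a scheme with uncoded placement is given: for each k ∈ Fin K a subset 𝒞_k ⊆ (Fin N) × (Fin B) with |𝒞_k| ≤ m, and for every demand matrix D ∈ Matrix (Fin K) (Fin N) F a natural number ℓ(D), an encoding function ψ_D : ((Fin N) → (Fin B) → F) → ((Fin ℓ(D)) → F), and decoding functions ξ_{k,D} such that for every library and every k, ξ_{k,D} applied to (the restriction of the library to 𝒞_k, ψ_D(library)) equals Σ_{i=1}^N D_{k,i}·F_i. Set M = m/B (a real number). Then for all real numbers a, b such that a + b·(N·t/K) ≤ (C(K,t+1) − C(K − min(K,N), t+1))/C(K,t) holds for every integer t with 0 ≤ t ≤ K, there exists a demand matrix D with ℓ(D)/B ≥ a + b·M. (Equivalently, the pair (M, worst-case load) lies on or above the lower convex envelope of the points (N·t/K, (C(K,t+1) − C(K − min(K,N), t+1))/C(K,t)), t = 0,…,K.) -/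
open Finset in
/-- Users served one after the other: the symbols of the `j`-th file that none of the first `j`
users caches must all be carried by the broadcast. -/
theorem card_uncached_le_broadcast {F κ ν β : Type*} [Field F] [Fintype F] [Fintype ν]
    [Fintype β] [DecidableEq ν] [DecidableEq β] {K : κ → Finset (ν × β)} {n r : ℕ}
    (ψ : (ν → β → F) → (Fin n → F))
    (ξ : ∀ k : κ, ({p : ν × β // p ∈ K k} → F) → (Fin n → F) → (β → F))
    (u : Fin r → κ) (i : Fin r → ν) (hi : Function.Injective i)
    (hdec : ∀ (lib : ν → β → F) (j : Fin r) (b : β),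
      ξ (u j) (fun p => lib p.1.1 p.1.2) (ψ lib) b = lib (i j) b) :
    ∑ j, #{b | ∀ j' ≤ j, (i j, b) ∉ K (u j')} ≤ n := by
  classical
  set S : Finset (Fin r × β) := {q | ∀ j' ≤ q.1, (i q.1, q.2) ∉ K (u j')} with hS
  set P : Finset (ν × β) := S.image (fun q => (i q.1, q.2)) with hP
  have hcard : ∑ j, #{b | ∀ j' ≤ j, (i j, b) ∉ K (u j')} = #P := by
    rw [hP, card_image_of_injective]
    · simp only [hS, card_filter, Fintype.sum_prod_type]
    · rintro ⟨j, b⟩ ⟨j', b'⟩ h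
      simp only [Prod.mk.injEq] at h ⊢
      exact ⟨hi h.1, h.2⟩
  rw [hcard]
  let ext (v : {p // p ∈ P} → F) : ν → β → F :=
    fun x b => if h : (x, b) ∈ P then v ⟨(x, b), h⟩ else 0
  have hinj : Function.Injective fun v => ψ (ext v) := by
    intro v w hvw
    have hvw : ψ (ext v) = ψ (ext w) := hvw
    have agree : ∀ (m : ℕ) (j : Fin r), j.1 = m → ext v (i j) = ext w (i j) := by
      intro m
      induction m using Nat.strong_induction_on with
      | _ m ih =>
        intro j hj
        funext b
        rw [← hdec (ext v) j b, ← hdec (ext w) j b, hvw]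
        congr 2
        funext ⟨⟨x, c⟩, hx⟩
        by_cases hmem : (x, c) ∈ P
        · obtain ⟨⟨j', b'⟩, hq, he⟩ := mem_image.1 hmem
          obtain ⟨rfl, rfl⟩ := Prod.mk.inj he
          have hlt : j' < j := by
            by_contra hle
            exact (mem_filter.1 hq).2 j (not_lt.1 hle) hx
          exact congrFun (ih j'.1 (hj ▸ hlt) j' rfl) _
        · simp [ext, hmem]
    funext ⟨⟨x, c⟩, hx⟩
    obtain ⟨⟨j, b⟩, -, he⟩ := mem_image.1 hx
    obtain ⟨rfl, rfl⟩ := Prod.mk.inj he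
    simpa [ext, hx] using congrFun (agree j.1 j rfl) b
  have := Fintype.card_le_of_injective _ hinj
  simp only [Fintype.card_fun, Fintype.card_coe, Fintype.card_fin] at this
  exact (Nat.pow_le_pow_iff_right Fintype.one_lt_card).1 this

open Finset in
/-- The number of permutations moving a given set `I` off a given set `S`, up to
normalization. -/
theorem choose_mul_card_perm_disjoint {α : Type*} [Fintype α] [DecidableEq α]
    (I S : Finset α) :
    (Fintype.card α).choose #S * #{σ : Equiv.Perm α | ∀ x ∈ I, σ x ∉ S} =
      (Fintype.card α).factorial * (Fintype.card α - #I).choose #S := by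
  have hinv : ∀ T ∈ powersetCard #S (univ : Finset α),
      #{σ : Equiv.Perm α | ∀ x ∈ I, σ x ∉ T} = #{σ : Equiv.Perm α | ∀ x ∈ I, σ x ∉ S} := by
    intro T hT
    have e : {x // x ∈ T} ≃ {x // x ∈ S} := equivOfCardEq (mem_powersetCard.1 hT).2
    let π : Equiv.Perm α := e.extendSubtype
    have hπ : ∀ x, π x ∈ S ↔ x ∈ T := fun x =>
      ⟨fun h => by_contra fun hx => e.extendSubtype_not_mem x hx h,
        fun h => e.extendSubtype_mem x h⟩
    refine card_bijective (fun σ => π * σ) (Group.mulLeft_bijective π) fun σ => ?_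
    simp [hπ]
  have hcount : ∀ σ : Equiv.Perm α,
      #{T ∈ powersetCard #S (univ : Finset α) | ∀ x ∈ I, σ x ∉ T} =
        (Fintype.card α - #I).choose #S := by
    intro σ
    have : {T ∈ powersetCard #S (univ : Finset α) | ∀ x ∈ I, σ x ∉ T} =
        powersetCard #S (I.map σ.toEmbedding)ᶜ := by
      ext T
      simp only [mem_filter, mem_powersetCard, subset_univ, true_and]
      rw [and_comm, subset_compl_comm]
      refine and_congr_left fun _ => ?_
      simp only [subset_iff, mem_compl, mem_map_equiv]
      exact ⟨fun h x hx hT => h _ hx (by simpa using hT), fun h x hx => h (by simpa using hx)⟩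
    rw [this, card_powersetCard, card_compl, card_map]
  calc _ = ∑ T ∈ powersetCard #S (univ : Finset α),
        #{σ : Equiv.Perm α | ∀ x ∈ I, σ x ∉ T} := by
        rw [sum_congr rfl hinv, sum_const, card_powersetCard, card_univ, smul_eq_mul]
    _ = ∑ σ : Equiv.Perm α,
        #{T ∈ powersetCard #S (univ : Finset α) | ∀ x ∈ I, σ x ∉ T} := by
        simp only [card_filter]
        exact sum_comm
    _ = _ := by simp [hcount, Fintype.card_perm]

theorem Nat.sum_range_choose_sub_succ {n r : ℕ} (t : ℕ) (hr : r ≤ n) :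
    ∑ j ∈ Finset.range r, (n - (j + 1)).choose t =
      n.choose (t + 1) - (n - r).choose (t + 1) := by
  suffices ∑ j ∈ Finset.range r, (n - (j + 1)).choose t + (n - r).choose (t + 1) =
      n.choose (t + 1) by omega
  induction r with
  | zero => simp
  | succ r ih =>
    have h : n - r = n - (r + 1) + 1 := by omega
    rw [Finset.sum_range_succ, ← ih (by omega), h, Nat.choose_succ_succ, add_assoc]

open Finset in
/-- Averaging over all orderings of the users gives the memory-load tradeoff value. -/
theorem sum_card_perm_prefix_disjoint {K r : ℕ} (hr : r ≤ K) (S : Finset (Fin K)) :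
    ((∑ j : Fin r, #{σ : Equiv.Perm (Fin K) |
        ∀ j' ≤ j, σ (Fin.castLE hr j') ∉ S} : ℕ) : ℝ) =
      K.factorial *
        (((K.choose (#S + 1) - (K - r).choose (#S + 1) : ℕ) : ℝ) / K.choose #S) := by
  have hS : #S ≤ K := by simpa using S.card_le_univ
  have hpos : (0 : ℝ) < K.choose #S := by exact_mod_cast Nat.choose_pos hS
  rw [mul_div_assoc', eq_div_iff hpos.ne']
  norm_cast
  rw [← Nat.sum_range_choose_sub_succ _ hr, ← Fin.sum_univ_eq_sum_range
    (fun j => (K - (j + 1)).choose #S), sum_mul, mul_sum]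
  refine sum_congr rfl fun j _ => ?_
  have := choose_mul_card_perm_disjoint ((Iic j).map (Fin.castLEEmb hr)) S
  simp only [Fintype.card_fin, card_map, Fin.card_Iic, mem_map, mem_Iic,
    forall_exists_index, and_imp, forall_apply_eq_imp_iff₂, Fin.castLEEmb_apply] at this
  rw [mul_comm, this]

open Finset in
/-- Theorem 2 (converse under uncoded placement): any scheme with uncoded cache placement
of at most `m` symbols per user has, for every affine lower bound on the memory-load
tradeoff points `(N*t/K, (C(K,t+1) - C(K - min K N, t+1))/C(K,t))`, some demand matrix
whose load is at least that affine bound evaluated at `M = m/B`. -/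
theorem thm2_converse_uncoded (F : Type) [Field F] [Fintype F]
    (K N B m : ℕ) (hK : 1 ≤ K) (hN : 1 ≤ N) (hB : 1 ≤ B) (hm : m ≤ N * B)
    (C : Fin K → Finset (Fin N × Fin B)) (hC : ∀ k, (C k).card ≤ m)
    (ℓ : Matrix (Fin K) (Fin N) F → ℕ)
    (ψ : ∀ D : Matrix (Fin K) (Fin N) F, (Fin N → Fin B → F) → (Fin (ℓ D) → F))
    (ξ : ∀ (D : Matrix (Fin K) (Fin N) F) (k : Fin K),
      ({p : Fin N × Fin B // p ∈ C k} → F) → (Fin (ℓ D) → F) → (Fin B → F))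
    (hcorrect : ∀ (D : Matrix (Fin K) (Fin N) F) (lib : Fin N → Fin B → F)
      (k : Fin K) (b : Fin B),
      ξ D k (fun p => lib p.1.1 p.1.2) (ψ D lib) b = ∑ i, D k i * lib i b)
    (a b : ℝ)
    (hab : ∀ t : ℕ, t ≤ K →
      a + b * ((N : ℝ) * t / K) ≤
        ((K.choose (t + 1) - (K - min K N).choose (t + 1) : ℕ) : ℝ) / (K.choose t : ℝ)) :
    ∃ D : Matrix (Fin K) (Fin N) F, (ℓ D : ℝ) / B ≥ a + b * ((m : ℝ) / B) := by
  have hKR : (0 : ℝ) < K := by exact_mod_cast hK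
  have hNR : (0 : ℝ) < N := by exact_mod_cast hN
  have hBR : (0 : ℝ) < B := by exact_mod_cast hB
  rcases le_or_gt 0 b with hb | hb
  · refine ⟨0, ?_⟩
    have h := hab K le_rfl
    rw [Nat.choose_succ_self, Nat.zero_sub, Nat.cast_zero, zero_div,
      mul_div_cancel_right₀ _ hKR.ne'] at h
    have hmN : (m : ℝ) / B ≤ N := by
      rw [div_le_iff₀ hBR]
      exact_mod_cast hm
    have : (0 : ℝ) ≤ (ℓ 0 : ℝ) / B := by positivity
    nlinarith [mul_le_mul_of_nonneg_left hmN hb]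
  by_contra! hlt
  have : NeZero N := ⟨by omega⟩
  set r := min K N with hr
  have hrK : r ≤ K := min_le_left _ _
  have hrN : r ≤ N := min_le_right _ _
  let S (p : Fin N × Fin B) : Finset (Fin K) := {k | p ∈ C k}
  let D (σ : Equiv.Perm (Fin K)) (s : Fin N) : Matrix (Fin K) (Fin N) F := fun k =>
    if h : (σ.symm k).1 < r then Pi.single (Fin.castLE hrN ⟨_, h⟩ + s) 1 else 0
  have hload : ∀ σ s, ∑ j : Fin r, #{c : Fin B | ∀ j' ≤ j,
      σ (Fin.castLE hrK j') ∉ S (Fin.castLE hrN j + s, c)} ≤ ℓ (D σ s) := by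
    intro σ s
    have := card_uncached_le_broadcast (ψ (D σ s)) (ξ (D σ s))
      (fun j : Fin r => σ (Fin.castLE hrK j)) (fun j => Fin.castLE hrN j + s)
      (fun j j' h => Fin.castLE_injective hrN (add_right_cancel h))
      (fun lib j c => by
        rw [hcorrect]
        simp [D, Pi.single_apply]
        rfl)
    simpa [S] using this
  have htotal : ∑ σ : Equiv.Perm (Fin K), ∑ s : Fin N, ∑ j : Fin r, #{c : Fin B | ∀ j' ≤ j,
        σ (Fin.castLE hrK j') ∉ S (Fin.castLE hrN j + s, c)} =
      ∑ p : Fin N × Fin B, ∑ j : Fin r, #{σ : Equiv.Perm (Fin K) |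
        ∀ j' ≤ j, σ (Fin.castLE hrK j') ∉ S p} := by
    have hshift : ∀ (σ : Equiv.Perm (Fin K)) (j : Fin r),
        ∑ s : Fin N, #{c : Fin B | ∀ j' ≤ j,
          σ (Fin.castLE hrK j') ∉ S (Fin.castLE hrN j + s, c)} =
        ∑ p : Fin N × Fin B, if ∀ j' ≤ j, σ (Fin.castLE hrK j') ∉ S p then 1 else 0 := by
      intro σ j
      rw [Fintype.sum_prod_type]
      simp only [card_filter]
      exact Equiv.sum_comp (Equiv.addLeft (Fin.castLE hrN j))
        (fun i => ∑ c : Fin B, if ∀ j' ≤ j, σ (Fin.castLE hrK j') ∉ S (i, c) then 1 else 0)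
    calc _ = ∑ σ : Equiv.Perm (Fin K), ∑ j : Fin r, ∑ p : Fin N × Fin B,
          if ∀ j' ≤ j, σ (Fin.castLE hrK j') ∉ S p then 1 else 0 :=
          sum_congr rfl fun σ _ => sum_comm.trans (sum_congr rfl fun j _ => hshift σ j)
      _ = _ := by
          simp only [card_filter]
          rw [sum_comm]
          conv_lhs => enter [2, j]; rw [sum_comm]
          exact sum_comm
  have hcache : (∑ p, (#(S p) : ℝ)) ≤ K * m := by
    have h : ∑ p, #(S p) = ∑ k, #(C k) := by
      simp only [S, card_filter]
      rw [sum_comm]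
      simp
    have h' : ∑ k, #(C k) ≤ K * m := by
      simpa using sum_le_card_nsmul univ (fun k => #(C k)) m fun k _ => hC k
    exact_mod_cast h.trans_le h'
  have hlower : (K.factorial : ℝ) * (N * (a * B + b * m)) ≤
      ∑ p : Fin N × Fin B, ((∑ j : Fin r, #{σ : Equiv.Perm (Fin K) |
        ∀ j' ≤ j, σ (Fin.castLE hrK j') ∉ S p} : ℕ) : ℝ) := by
    simp only [sum_card_perm_prefix_disjoint]
    rw [← mul_sum]
    refine mul_le_mul_of_nonneg_left ?_ (by positivity)
    calc (N : ℝ) * (a * B + b * m) = N * B * a + b * N / K * (K * m) := by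
          field_simp
      _ ≤ N * B * a + b * N / K * ∑ p, (#(S p) : ℝ) := by
          refine add_le_add_right (mul_le_mul_of_nonpos_left hcache ?_) _
          exact div_nonpos_of_nonpos_of_nonneg
            (mul_nonpos_of_nonpos_of_nonneg hb.le hNR.le) hKR.le
      _ = ∑ p : Fin N × Fin B, (a + b * (N * (#(S p) : ℝ) / K)) := by
          rw [sum_add_distrib, mul_sum]
          congr 1
          · simp
          · exact sum_congr rfl fun p _ => by ring
      _ ≤ _ := sum_le_sum fun p _ => hab _ (by simpa using (S p).card_le_univ)
  have hupper : ∑ σ : Equiv.Perm (Fin K), ∑ s : Fin N, (ℓ (D σ s) : ℝ) <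
      K.factorial * (N * (a * B + b * m)) := by
    have hone : ∀ D, (ℓ D : ℝ) < a * B + b * m := by
      intro D
      have := (div_lt_iff₀ hBR).1 (hlt D)
      rwa [add_mul, mul_assoc, div_mul_cancel₀ _ hBR.ne'] at this
    calc _ < ∑ σ : Equiv.Perm (Fin K), ∑ s : Fin N, (a * B + b * m) :=
          sum_lt_sum_of_nonempty univ_nonempty fun σ _ =>
            sum_lt_sum_of_nonempty univ_nonempty fun s _ => hone _
      _ = _ := by simp [Fintype.card_perm, mul_add]
  have hle : ∑ p : Fin N × Fin B, ((∑ j : Fin r, #{σ : Equiv.Perm (Fin K) |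
        ∀ j' ≤ j, σ (Fin.castLE hrK j') ∉ S p} : ℕ) : ℝ) ≤
      ∑ σ : Equiv.Perm (Fin K), ∑ s : Fin N, (ℓ (D σ s) : ℝ) := by
    rw [← Nat.cast_sum, ← htotal]
    exact_mod_cast sum_le_sum fun σ _ => sum_le_sum fun s _ => hload σ s
  exact absurd (hlower.trans hle) (not_le.2 hupper)
end

section
/- Corollary 2 (D2D cache-aided scalar linear function retrieval, achievability). Let F be a finite field, K ≥ 1, N ≥ 1 integers, t an integer with 1 ≤ t ≤ K, and B ≥ 1 with t·C(K,t) dividing B. Then there exist subsets 𝒞_k ⊆ (Fin N) × (Fin B) with |𝒞_k| = N·(B/C(K,t))·C(K−1,t−1) (an uncoded placement of N·t·B/K symbols per user) such that for every demand matrix D ∈ Matrix (Fin K) (Fin N) F there exist, for each user k ∈ Fin K, an encoding function ψ_{k,D} depending only on the restriction of the library to 𝒞_k, producing ℓ_k(D) = (B/(K·C(K−1,t−1)))·(C(K−1,t) − C(K−1−rank_F(D_{−k}), t)) symbols of F — where D_{−k} is the submatrix of D obtained by deleting row k — and decoding functions ξ_{k,D} taking user k's cached symbols together with all K transmissions (ψ_{1,D},…,ψ_{K,D})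 applied to the library, such that for every library, ξ_{k,D} outputs Σ_{i=1}^N D_{k,i}·F_i ∈ F^B. Consequently the total number of transmitted symbols is Σ_k ℓ_k(D) = B·(C(K−1,t) − (1/K)·Σ_{k∈Fin K} C(K−1−rank_F(D_{−k}), t))/C(K−1,t−1). -/
open Module in
/-- The exterior power of the quotient map by `V` has kernel of codimension
`C(dim M - dim V, n)` in `⋀ⁿ M`. -/
theorem exteriorPower.finrank_ker_map_mkQ {F M : Type*} [Field F] [AddCommGroup M] [Module F M]
    [FiniteDimensional F M] (V : Submodule F M) (n : ℕ) :
    finrank F (LinearMap.ker (exteriorPower.map n V.mkQ)) =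
      (finrank F M).choose n - (finrank F M - finrank F V).choose n := by
  have h := LinearMap.finrank_range_add_finrank_ker (exteriorPower.map n V.mkQ)
  rw [LinearMap.range_eq_top.2 (exteriorPower.map_surjective V.mkQ_surjective), finrank_top,
    exteriorPower.finrank_eq, exteriorPower.finrank_eq, Submodule.finrank_quotient] at h
  omega

/-- Left exterior multiplication by a vector, as a map between exterior powers. -/
noncomputable def exteriorPower.mulLeft {F M : Type*} [Field F] [AddCommGroup M] [Module F M]
    (n : ℕ) (v : M) : ⋀[F]^n M →ₗ[F] ⋀[F]^(n + 1) M :=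
  exteriorPower.alternatingMapLinearEquiv ((exteriorPower.ιMulti F (n + 1)).curryLeft v)

theorem exteriorPower.mulLeft_ιMulti {F M : Type*} [Field F] [AddCommGroup M] [Module F M]
    {n : ℕ} (v : M) (a : Fin n → M) :
    exteriorPower.mulLeft n v (exteriorPower.ιMulti F n a) =
      exteriorPower.ιMulti F (n + 1) (Matrix.vecCons v a) := by
  simp [exteriorPower.mulLeft]

theorem exteriorPower.coe_mulLeft {F M : Type*} [Field F] [AddCommGroup M] [Module F M]
    {n : ℕ} (v : M) (x : ⋀[F]^n M) :
    (exteriorPower.mulLeft n v x : ExteriorAlgebra F M) = ExteriorAlgebra.ι F v * x := by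
  have h : (⋀[F]^(n + 1) M).subtype ∘ₗ exteriorPower.mulLeft n v =
      LinearMap.mulLeft F (ExteriorAlgebra.ι F v) ∘ₗ (⋀[F]^n M).subtype := by
    ext a
    simp [exteriorPower.mulLeft_ιMulti, ExteriorAlgebra.ιMulti_succ_apply]
  exact LinearMap.congr_fun h x

theorem exteriorPower.map_mulLeft_eq_zero {F M M' : Type*} [Field F] [AddCommGroup M] [Module F M]
    [AddCommGroup M'] [Module F M'] {n : ℕ} (f : M →ₗ[F] M') {v : M} (hv : f v = 0)
    (x : ⋀[F]^n M) :
    exteriorPower.map (n + 1) f (exteriorPower.mulLeft n v x) = 0 := by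
  have h : exteriorPower.map (n + 1) f ∘ₗ exteriorPower.mulLeft n v = 0 := by
    ext a : 2
    simp only [LinearMap.compAlternatingMap_apply, LinearMap.comp_apply,
      exteriorPower.mulLeft_ιMulti, exteriorPower.map_apply_ιMulti, LinearMap.zero_apply]
    exact (exteriorPower.ιMulti F (n + 1)).map_coord_zero 0 (by simp [hv])
  exact LinearMap.congr_fun h x

open CliffordAlgebra in
/-- Contraction by `δ` kills an exterior product of vectors in the kernel of `δ`. -/
theorem ExteriorAlgebra.contractLeft_ιMulti_eq_zero {F M : Type*} [Field F] [AddCommGroup M]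
    [Module F M] (δ : Module.Dual F M) {n : ℕ} (a : Fin n → M) (ha : ∀ i, δ (a i) = 0) :
    contractLeft (Q := (0 : QuadraticForm F M)) δ (ExteriorAlgebra.ιMulti F n a) = 0 := by
  induction n with
  | zero => rw [ExteriorAlgebra.ιMulti_zero_apply]; exact contractLeft_one (d := δ) _
  | succ n ih =>
    rw [ExteriorAlgebra.ιMulti_succ_apply]
    refine (contractLeft_ι_mul δ (a 0) _).trans ?_
    rw [ha, ih (Matrix.vecTail a) fun i => ha i.succ]
    simp

open Module in
/-- A linear map into a subspace of dimension `L` can be encoded with `L` scalars. -/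
theorem LinearMap.exists_fun_ker_le {F W E : Type*} [Field F] [AddCommGroup W] [Module F W]
    [AddCommGroup E] [Module F E] [FiniteDimensional F E] (X : W →ₗ[F] E) {S : Submodule F E}
    (hX : ∀ w, X w ∈ S) {L : ℕ} (hL : finrank F S = L) :
    ∃ Y : W →ₗ[F] (Fin L → F), ∀ w, Y w = 0 → X w = 0 := by
  let c := (finBasisOfFinrankEq F S hL).equivFun
  refine ⟨c.toLinearMap ∘ₗ X.codRestrict S hX, fun w hw => ?_⟩
  exact congrArg Subtype.val (c.map_eq_zero_iff.1 hw)

open Module in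
/-- Server-based scalar linear function retrieval, one symbol per subfile: file `i` is
`W i : powersetCard ι m → F`, user `u` caches the subfiles `T ∋ u` and demands
`∑ i, d i u * W i T`. The code `Y` is linear, so decodability is stated for a library that
vanishes on the cache and on the transmission. -/
theorem exists_linear_broadcast {F ι κ : Type*} [Field F] [Fintype ι] [LinearOrder ι] [Fintype κ]
    (m : ℕ) (d : κ → ι → F) {L : ℕ}
    (hL : L = (Fintype.card ι).choose (m + 1) -
      (Fintype.card ι - finrank F (Submodule.span F (Set.range d))).choose (m + 1)) :
    ∃ Y : (κ → Set.powersetCard ι m → F) →ₗ[F] (Fin L → F), ∀ W, Y W = 0 → ∀ u : ι,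
      (∀ i T, u ∈ T → W i T = 0) → ∀ T, ∑ i, d i u * W i T = 0 := by
  classical
  set V := Submodule.span F (Set.range d)
  set b := (Pi.basisFun F ι).exteriorPower m
  let X : (κ → Set.powersetCard ι m → F) →ₗ[F] ⋀[F]^(m + 1) (ι → F) :=
    ∑ i, exteriorPower.mulLeft m (d i) ∘ₗ b.equivFun.symm.toLinearMap ∘ₗ LinearMap.proj i
  have hX (W) : X W ∈ LinearMap.ker (exteriorPower.map (m + 1) V.mkQ) := by
    rw [LinearMap.mem_ker]
    simp only [X, LinearMap.sum_apply, map_sum, LinearMap.comp_apply]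
    refine Finset.sum_eq_zero fun i _ => exteriorPower.map_mulLeft_eq_zero _ ?_ _
    exact (Submodule.Quotient.mk_eq_zero _).2 (Submodule.subset_span ⟨i, rfl⟩)
  have hdim : finrank F (LinearMap.ker (exteriorPower.map (m + 1) V.mkQ)) = L := by
    rw [exteriorPower.finrank_ker_map_mkQ, hL, finrank_fintype_fun_eq_card]
  obtain ⟨Y, hY⟩ := X.exists_fun_ker_le hX hdim
  refine ⟨Y, fun W hW u hu T => ?_⟩
  have hXW : X W = 0 := hY W hW
  set w := fun i => b.equivFun.symm (W i)
  have hw (i) : CliffordAlgebra.contractLeft (Q := (0 : QuadraticForm F (ι → F)))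
      (LinearMap.proj u : (ι → F) →ₗ[F] F) (w i : ExteriorAlgebra F (ι → F)) = 0 := by
    simp only [w, Basis.equivFun_symm_apply, Submodule.coe_sum, map_sum, Submodule.coe_smul,
      map_smul]
    refine Finset.sum_eq_zero fun S _ => ?_
    by_cases hS : u ∈ S
    · simp [hu i S hS]
    · rw [exteriorPower.basis_apply]
      refine smul_eq_zero_of_right _
        (ExteriorAlgebra.contractLeft_ιMulti_eq_zero _ _ fun j => ?_)
      have hne : Set.powersetCard.ofFinEmbEquiv.symm S j ≠ u := by
        rintro rfl
        exact hS ((Set.powersetCard.mem_range_ofFinEmbEquiv_symm_iff_mem S _).1 ⟨j, rfl⟩)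
      simp [hne.symm]
  have hsum : ∑ i, d i u • w i = 0 := by
    have h := congrArg (fun x : ⋀[F]^(m + 1) (ι → F) =>
      CliffordAlgebra.contractLeft (Q := (0 : QuadraticForm F (ι → F)))
        (LinearMap.proj u : (ι → F) →ₗ[F] F) (x : ExteriorAlgebra F (ι → F))) hXW
    apply Subtype.val_injective
    simp only [X, LinearMap.sum_apply, LinearMap.comp_apply, Submodule.coe_sum, map_sum,
      exteriorPower.coe_mulLeft, ZeroMemClass.coe_zero, map_zero] at h
    simp only [Submodule.coe_sum, Submodule.coe_smul, ZeroMemClass.coe_zero]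
    rw [← h]
    refine Finset.sum_congr rfl fun i _ => ?_
    refine Eq.symm ((CliffordAlgebra.contractLeft_ι_mul _ _ _).trans ?_)
    exact (congrArg (fun x => d i u • (w i : ExteriorAlgebra F (ι → F)) -
      ExteriorAlgebra.ι F (d i) * x) (hw i)).trans (by simp)
  have h := congrFun (congrArg b.equivFun hsum) T
  simpa only [w, map_sum, map_smul, map_zero, LinearEquiv.apply_symm_apply, Finset.sum_apply,
    Pi.smul_apply, Pi.zero_apply, smul_eq_mul] using h

/-- The number of `m`-subsets avoiding a given element. -/
theorem card_powersetCard_notMem {α : Type*} [Fintype α] [DecidableEq α] (m : ℕ) (u : α) :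
    Nat.card {T : Set.powersetCard α m // u ∉ T} = (Fintype.card α - 1).choose m := by
  rw [← Finset.card_univ, ← Finset.card_erase_of_mem (Finset.mem_univ u),
    ← Finset.card_powersetCard, ← Nat.card_eq_finsetCard]
  refine Nat.card_congr
    { toFun := fun T => ⟨T.1.1, Finset.mem_powersetCard.2 ⟨fun x hx => ?_, T.1.2⟩⟩
      invFun := fun S => ⟨⟨S.1, (Finset.mem_powersetCard.1 S.2).2⟩, fun h => ?_⟩
      left_inv := fun _ => rfl
      right_inv := fun _ => rfl }
  · exact Finset.mem_erase.2 ⟨fun h => T.2 (h ▸ hx), Finset.mem_univ x⟩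
  · exact Finset.notMem_erase u _ ((Finset.mem_powersetCard.1 S.2).1 h)

/-- Labels `(j, T)` of the pieces of a file: piece `(j, T)` is broadcast by user `j`, who serves
the other users, and is cached by user `j` and the users in `T`. -/
abbrev PieceLabel (K m : ℕ) : Type :=
  Σ j : Fin K, Set.powersetCard {k : Fin K // k ≠ j} m

/-- User `k` caches the piece with the given label. -/
def PieceLabel.CachedBy {K m : ℕ} (x : PieceLabel K m) (k : Fin K) : Prop :=
  ∀ h : k ≠ x.1, (⟨k, h⟩ : {k : Fin K // k ≠ x.1}) ∈ x.2

theorem PieceLabel.card (K m : ℕ) : Nat.card (PieceLabel K m) = K * (K - 1).choose m := by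
  rw [Nat.card_sigma]
  simp only [Set.powersetCard.card]
  simp

theorem PieceLabel.card_not_cachedBy {K m : ℕ} (k : Fin K) :
    Nat.card {x : PieceLabel K m // ¬ x.CachedBy k} = (K - 1) * (K - 1 - 1).choose m := by
  have e : {x : PieceLabel K m // ¬ x.CachedBy k} ≃
      Σ j : {j : Fin K // k ≠ j}, {T : Set.powersetCard {k : Fin K // k ≠ j.1} m //
        (⟨k, j.2⟩ : {k : Fin K // k ≠ j.1}) ∉ T} :=
    { toFun := fun x => ⟨⟨x.1.1, (not_forall.1 x.2).1⟩, ⟨x.1.2, (not_forall.1 x.2).2⟩⟩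
      invFun := fun y => ⟨⟨y.1.1, y.2.1⟩, fun h => y.2.2 (h y.1.2)⟩
      left_inv := fun _ => rfl
      right_inv := fun _ => rfl }
  rw [Nat.card_congr e, Nat.card_sigma]
  simp [card_powersetCard_notMem]

theorem PieceLabel.card_cachedBy {K m : ℕ} (hm : m < K) (k : Fin K) :
    Nat.card {x : PieceLabel K m // x.CachedBy k} = (m + 1) * (K - 1).choose m := by
  classical
  have h := Nat.card_congr (Equiv.sumCompl fun x : PieceLabel K m => x.CachedBy k)
  rw [Nat.card_sum, PieceLabel.card_not_cachedBy, PieceLabel.card] at h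
  obtain ⟨n, rfl⟩ : ∃ n, K = n + 1 := ⟨K - 1, by omega⟩
  have h2 : n * (n - 1).choose m = (n - m) * n.choose m := by
    rcases n with _ | n
    · simp
    · have := Nat.choose_mul_succ_eq n m
      simp only [Nat.add_sub_cancel]
      linarith
  simp only [Nat.add_sub_cancel] at h ⊢
  rw [h2] at h
  obtain ⟨q, rfl⟩ : ∃ q, n = m + q := ⟨n - m, by omega⟩
  simp only [Nat.add_sub_cancel_left] at h
  linarith

/-- A quantity determined by an observation can be computed from it. -/
theorem exists_decoder {α β γ δ : Type*} [Nonempty δ] (f : α → β) (g : α → γ) (h : α → δ)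
    (hfg : ∀ a a', f a = f a' → g a = g a' → h a = h a') :
    ∃ ξ : β → γ → δ, ∀ a, ξ (f a) (g a) = h a := by
  classical
  refine ⟨fun y z => if H : ∃ a, f a = y ∧ g a = z then h H.choose else Classical.arbitrary δ,
    fun a => ?_⟩
  have H : ∃ a', f a' = f a ∧ g a' = g a := ⟨a, rfl, rfl⟩
  simp only [dif_pos H]
  exact hfg _ _ H.choose_spec.1 H.choose_spec.2


/-- Corollary 2 (D2D cache-aided scalar linear function retrieval, achievability):
with uncoded placement of `N*t*B/K` symbols per user, for every demand matrix `D`,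
each user `k` can broadcast `ℓ k = (B/(K*C(K-1,t-1))) * (C(K-1,t) - C(K-1-rank(D_{-k}), t))`
symbols computed from its own cache such that everybody decodes its demanded scalar
linear function; the total number of transmitted symbols is
`B*(C(K-1,t) - (1/K) ∑_k C(K-1-rank(D_{-k}), t))/C(K-1,t-1)`. -/
theorem cor2_d2d_achievability (F : Type) [Field F] [Fintype F]
    (K N t B : ℕ) (hK : 1 ≤ K) (hN : 1 ≤ N) (hB : 1 ≤ B)
    (ht1 : 1 ≤ t) (htK : t ≤ K) (hdvd : t * K.choose t ∣ B) :
    ∃ C : Fin K → Finset (Fin N × Fin B),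
      (∀ k, (C k).card = N * (B / K.choose t) * ((K - 1).choose (t - 1))) ∧
      ∀ D : Matrix (Fin K) (Fin N) F,
        ∃ ℓ : Fin K → ℕ,
          (∀ k, ℓ k = B / (K * (K - 1).choose (t - 1)) *
            ((K - 1).choose t -
              (K - 1 -
                (D.submatrix (fun j : {j : Fin K // j ≠ k} => (j : Fin K)) id).rank).choose t)) ∧
          ∃ ψ : ∀ k : Fin K, ({p : Fin N × Fin B // p ∈ C k} → F) → (Fin (ℓ k) → F),
          ∃ ξ : ∀ k : Fin K, ({p : Fin N × Fin B // p ∈ C k} → F) →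
              (∀ j : Fin K, Fin (ℓ j) → F) → (Fin B → F),
            (∀ (lib : Fin N → Fin B → F) (k : Fin K) (b : Fin B),
              ξ k (fun p => lib p.1.1 p.1.2)
                  (fun j => ψ j (fun p => lib p.1.1 p.1.2)) b = ∑ i, D k i * lib i b) ∧
            (∑ k, (ℓ k : ℝ)) =
              (B : ℝ) * (((K - 1).choose t : ℝ) -
                (K : ℝ)⁻¹ * ∑ k : Fin K,
                  (((K - 1 -
                    (D.submatrix (fun j : {j : Fin K // j ≠ k} => (j : Fin K)) id).rank).choose t
                      : ℕ) : ℝ)) /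
                ((K - 1).choose (t - 1) : ℝ) := by
  classical
  obtain ⟨m, rfl⟩ : ∃ m, t = m + 1 := ⟨t - 1, by omega⟩
  obtain ⟨s, hs⟩ := hdvd
  simp only [Nat.add_sub_cancel]
  have hP : 0 < (K - 1).choose m := Nat.choose_pos (by omega)
  have hKt : 0 < K.choose (m + 1) := Nat.choose_pos htK
  have hid : (m + 1) * K.choose (m + 1) = K * (K - 1).choose m := by
    obtain ⟨n, rfl⟩ : ∃ n, K = n + 1 := ⟨K - 1, by omega⟩
    have := Nat.add_one_mul_choose_eq n m
    simp only [Nat.add_sub_cancel]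
    linarith
  have hB2 : B = K * (K - 1).choose m * s := by rw [hs, hid]
  have hdiv1 : B / (K * (K - 1).choose m) = s := by
    rw [hB2]; exact Nat.mul_div_cancel_left _ (by positivity)
  have hdiv2 : B / K.choose (m + 1) = (m + 1) * s := by
    rw [hs, show (m + 1) * K.choose (m + 1) * s = K.choose (m + 1) * ((m + 1) * s) by ring]
    exact Nat.mul_div_cancel_left _ hKt
  have e : Fin B ≃ PieceLabel K m × Fin s := by
    refine Fintype.equivOfCardEq ?_
    rw [← Nat.card_eq_fintype_card, ← Nat.card_eq_fintype_card, Nat.card_prod, PieceLabel.card]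
    simp [hB2]
  rw [hdiv1, hdiv2]
  let C : Fin K → Finset (Fin N × Fin B) := fun k =>
    Finset.univ.filter fun p => (e p.2).1.CachedBy k
  have hmemC (k i b) : (i, b) ∈ C k ↔ (e b).1.CachedBy k := by simp [C]
  refine ⟨C, fun k => ?_, fun D => ?_⟩
  · have e' : C k ≃ Fin N × ({x : PieceLabel K m // x.CachedBy k} × Fin s) :=
      { toFun := fun p => (p.1.1, ⟨(e p.1.2).1, (hmemC k _ _).1 p.2⟩, (e p.1.2).2)
        invFun := fun q => ⟨(q.1, e.symm (q.2.1.1, q.2.2)), (hmemC k _ _).2 (by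
          rw [Equiv.apply_symm_apply]; exact q.2.1.2)⟩
        left_inv := fun p => by simp
        right_inv := fun q => by
          refine Prod.ext rfl (Prod.ext (Subtype.ext ?_) ?_) <;> simp }
    rw [← Nat.card_eq_finsetCard, Nat.card_congr e', Nat.card_prod, Nat.card_prod,
      PieceLabel.card_cachedBy (by omega)]
    simp only [Nat.card_eq_fintype_card, Fintype.card_fin]
    ring
  · set r : Fin K → ℕ := fun k =>
      (D.submatrix (fun j : {j : Fin K // j ≠ k} => (j : Fin K)) id).rank
    set L : Fin K → ℕ := fun k => (K - 1).choose (m + 1) - (K - 1 - r k).choose (m + 1)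
    have hY (j : Fin K) := exists_linear_broadcast m
      (fun i (k : {k : Fin K // k ≠ j}) => D k i) (L := L j) (by
        simp only [L, r, Matrix.rank_eq_finrank_span_cols]
        simp
        rfl)
    choose Y hY using hY
    have hcached (j) (T : Set.powersetCard {k : Fin K // k ≠ j} m) (a i) :
        (i, e.symm (⟨j, T⟩, a)) ∈ C j := by
      rw [hmemC, Equiv.apply_symm_apply]
      exact fun h => absurd rfl h
    let pieces (lib : Fin N → Fin B → F) (j : Fin K) (a : Fin s) :
        Fin N → Set.powersetCard {k : Fin K // k ≠ j} m → F :=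
      fun i T => lib i (e.symm (⟨j, T⟩, a))
    let ψ : ∀ k : Fin K, ({p : Fin N × Fin B // p ∈ C k} → F) → (Fin (s * L k) → F) :=
      fun k c x => Y k (fun i T => c ⟨_, hcached k T (finProdFinEquiv.symm x).1 i⟩)
        (finProdFinEquiv.symm x).2
    have hdec (k : Fin K) : ∃ ξ : ({p : Fin N × Fin B // p ∈ C k} → F) →
        (∀ j : Fin K, Fin (s * L j) → F) → (Fin B → F), ∀ lib : Fin N → Fin B → F,
        ξ (fun p => lib p.1.1 p.1.2) (fun j => ψ j (fun p => lib p.1.1 p.1.2)) =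
          fun b => ∑ i, D k i * lib i b := by
      refine exists_decoder (fun (lib : Fin N → Fin B → F) (p : {p // p ∈ C k}) =>
        lib p.1.1 p.1.2) (fun lib j => ψ j (fun p => lib p.1.1 p.1.2)) _
        fun lib lib' hc hψ => funext fun b => ?_
      have hc' (i b) (h : (e b).1.CachedBy k) : lib i b = lib' i b :=
        congrFun hc ⟨(i, b), (hmemC k i b).2 h⟩
      obtain ⟨⟨⟨j, T⟩, a⟩, rfl⟩ := e.symm.surjective b
      by_cases hkj : k = j
      · refine Finset.sum_congr rfl fun i _ => ?_
        rw [hc' i _ ((hmemC k i _).1 (hkj ▸ hcached j T a i))]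
      · have hYa : Y j (pieces lib j a - pieces lib' j a) = 0 := by
          rw [map_sub, sub_eq_zero]
          ext q
          simpa only [ψ, pieces, Equiv.symm_apply_apply] using congrFun (congrFun hψ j) (finProdFinEquiv (a, q))
        have h := hY j _ hYa ⟨k, hkj⟩ (fun i S hS => sub_eq_zero.2 (hc' i _ (by
          rw [Equiv.apply_symm_apply]; exact fun _ => hS))) T
        simpa [pieces, mul_sub, sub_eq_zero] using h
    choose ξ hξ using hdec
    refine ⟨fun k => s * L k, fun k => rfl, ψ, ξ, fun lib k b => congrFun (hξ k lib) b, ?_⟩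
    have hle (k) : (K - 1 - r k).choose (m + 1) ≤ (K - 1).choose (m + 1) :=
      Nat.choose_le_choose _ (Nat.sub_le _ _)
    have hK0 : (K : ℝ) ≠ 0 := by positivity
    have hP0 : ((K - 1).choose m : ℝ) ≠ 0 := by positivity
    have hBR : (B : ℝ) = K * ((K - 1).choose m : ℝ) * s := by exact_mod_cast hB2
    change _ = (B : ℝ) * (((K - 1).choose (m + 1) : ℝ) - (K : ℝ)⁻¹ *
      ∑ k, ((K - 1 - r k).choose (m + 1) : ℝ)) / ((K - 1).choose m : ℝ)
    simp only [L, Nat.cast_mul, Nat.cast_sub (hle _), ← Finset.mul_sum, Finset.sum_sub_distrib,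
      Finset.sum_const, Finset.card_univ, Fintype.card_fin, nsmul_eq_mul, hBR]
    field_simp
end

section
/- Lemma 1 (F_2 decodability). Let K, N, t be natural numbers and let D be a K × N matrix over the field F_2 = ZMod 2. Let L ⊆ Fin K (the 'leaders') satisfy |L| = rank(D_L) = rank(D), where D_L is the submatrix of D consisting of the rows indexed by L and ranks are over F_2. Let A ⊆ Fin K with A ∩ L = ∅ and |A| = t + 1, and set B := L ∪ A. Then for every subset W ⊆ B with |W| = t and every column index i ∈ Fin N, the number of elements k ∈ B \ W such that (i) the submatrix of D consisting of the rows indexed by B \ (W ∪ {k}) has rank |L| over F_2, and (ii) D_{k,i} ≠ 0, is even. -/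
/-- Over `F₂`, if `v` is linearly dependent on `s`, the vectors whose removal leaves a linearly
independent family sum to zero: they are either none at all, or the support of the unique
nontrivial relation. -/
theorem sum_filter_linearIndepOn_erase_eq_zero {ι M : Type*} [DecidableEq ι] [AddCommGroup M]
    [Module (ZMod 2) M] (v : ι → M) (s : Finset ι)
    [DecidablePred fun k => LinearIndepOn (ZMod 2) v (s.erase k : Finset ι)]
    (hs : ¬ LinearIndepOn (ZMod 2) v (s : Set ι)) :
    ∑ k ∈ s with LinearIndepOn (ZMod 2) v (s.erase k : Finset ι), v k = 0 := by
  by_cases h : ∃ k ∈ s, LinearIndepOn (ZMod 2) v (s.erase k : Finset ι)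
  swap
  · push Not at h
    rw [Finset.filter_false_of_mem h, Finset.sum_empty]
  obtain ⟨a, ha, hind⟩ := h
  have eq_one : ∀ x : ZMod 2, x ≠ 0 → x = 1 := by decide
  have relation_eq_zero : ∀ {k} {g : ι → ZMod 2},
      LinearIndepOn (ZMod 2) v (s.erase k : Finset ι) →
      ∑ i ∈ s, g i • v i = 0 → g k = 0 → ∀ i ∈ s, g i = 0 := by
    intro k g hk hg hgk i hi
    by_cases hik : i = k
    · rwa [hik]
    · refine linearIndepOn_finset_iff.1 hk g ?_ i (Finset.mem_erase.2 ⟨hik, hi⟩)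
      rwa [Finset.sum_erase _ (by rw [hgk, zero_smul])]
  obtain ⟨c, hc, b, hb, hcb⟩ : ∃ c : ι → ZMod 2, ∑ i ∈ s, c i • v i = 0 ∧ ∃ b ∈ s, c b ≠ 0 := by
    rw [linearIndepOn_finset_iff] at hs
    push Not at hs
    exact hs
  have hca : c a = 1 := eq_one _ fun h => hcb (relation_eq_zero hind hc h b hb)
  have indep_iff : ∀ k ∈ s, LinearIndepOn (ZMod 2) v (s.erase k : Finset ι) ↔ c k ≠ 0 := by
    intro k hk
    refine ⟨fun hi h => hcb (relation_eq_zero hi hc h b hb), fun hck => ?_⟩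
    rw [linearIndepOn_finset_iff]
    intro g hg
    let g' : ι → ZMod 2 := Function.update g k 0
    have hg' : ∀ i ∈ s.erase k, g' i = g i := fun i hi =>
      Function.update_of_ne (Finset.ne_of_mem_erase hi) _ _
    have hg'k : g' k = 0 := Function.update_self _ _ _
    have hsum : ∑ i ∈ s, g' i • v i = 0 := by
      rw [← Finset.sum_erase s (a := k) (by rw [hg'k, zero_smul]), ← hg]
      exact Finset.sum_congr rfl fun i hi => by rw [hg' i hi]
    by_cases hga : g' a = 0
    · intro i hi
      rw [← hg' i hi]
      exact relation_eq_zero hind hsum hga i (Finset.mem_of_mem_erase hi)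
    · have hdiff := relation_eq_zero (g := c - g') hind
        (by simp [sub_smul, Finset.sum_sub_distrib, hc, hsum])
        (by simp [hca, eq_one _ hga]) k hk
      exact absurd (by simpa [hg'k] using hdiff) hck
  rw [Finset.filter_congr indep_iff, Finset.sum_filter]
  refine (Finset.sum_congr rfl fun i _ => ?_).trans hc
  by_cases h : c i = 0
  · simp [h]
  · rw [if_pos h, eq_one _ h, one_smul]

/-- A set of rows has full rank exactly when it is linearly independent. -/
theorem Matrix.rank_submatrix_eq_card_iff_linearIndepOn {m n R : Type*} [Fintype n] [Field R]
    (D : Matrix m n R) (s : Finset m) :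
    (D.submatrix (fun j : {j : m // j ∈ s} => (j : m)) id).rank = s.card ↔
      LinearIndepOn R D.row (s : Set m) := by
  rw [Matrix.rank_eq_finrank_span_row, eq_comm, ← Fintype.card_coe]
  exact linearIndependent_iff_card_eq_finrank_span.symm


/-- Lemma 1 (F₂ decodability): with leaders `L` satisfying
`|L| = rank(D_L) = rank(D)` over `F₂`, and `A` a set of `t+1` non-leaders with
`B = L ∪ A`, for every `W ⊆ B` of size `t` and every column `i`, the number of
`k ∈ B \ W` such that the rows of `D` indexed by `B \ (W ∪ {k})` have rank `|L|`
and `D k i ≠ 0` is even. -/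
theorem lem1_F2_decodability (K N t : ℕ) (D : Matrix (Fin K) (Fin N) (ZMod 2))
    (L : Finset (Fin K))
    (hL1 : L.card = (D.submatrix (fun j : {j : Fin K // j ∈ L} => (j : Fin K)) id).rank)
    (hL2 : L.card = D.rank)
    (A : Finset (Fin K)) (hAL : A ∩ L = ∅) (hA : A.card = t + 1)
    (W : Finset (Fin K)) (hW : W ⊆ L ∪ A) (hWt : W.card = t)
    (i : Fin N) :
    Even ((((L ∪ A) \ W).filter (fun k =>
      (D.submatrix
        (fun j : {j : Fin K // j ∈ (L ∪ A) \ insert k W} => (j : Fin K)) id).rank = L.card ∧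
      D k i ≠ 0)).card) := by
  classical
  have hcard : ((L ∪ A) \ W).card = L.card + 1 := by
    rw [Finset.card_sdiff_of_subset hW,
      Finset.card_union_of_disjoint (Finset.disjoint_iff_inter_eq_empty.2 hAL).symm]
    omega
  set s := (L ∪ A) \ W with hs
  have hdep : ¬ LinearIndepOn (ZMod 2) D.row (s : Set (Fin K)) := by
    intro h
    have hrank := (D.rank_submatrix_eq_card_iff_linearIndepOn s).2 h
    have hle := D.rank_submatrix_le (fun j : {j : Fin K // j ∈ s} => (j : Fin K)) id
    omega
  have hrank : ∀ k ∈ s,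
      ((D.submatrix
        (fun j : {j : Fin K // j ∈ (L ∪ A) \ insert k W} => (j : Fin K)) id).rank = L.card ↔
      LinearIndepOn (ZMod 2) D.row (s.erase k : Finset (Fin K))) := by
    intro k hk
    rw [← D.rank_submatrix_eq_card_iff_linearIndepOn, Finset.card_erase_of_mem hk, hcard,
      Nat.add_sub_cancel, hs, ← Finset.sdiff_insert]
  have hsum := congrFun (sum_filter_linearIndepOn_erase_eq_zero D.row s hdep) i
  rw [Finset.sum_apply, Pi.zero_apply] at hsum
  rw [Finset.filter_congr fun k hk => and_congr_left' (hrank k hk), ← Finset.filter_filter,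
    ← ZMod.natCast_eq_zero_iff_even, Finset.card_filter, Nat.cast_sum]
  refine (Finset.sum_congr rfl fun k _ => ?_).trans hsum
  have eq_ite : ∀ x : ZMod 2, ((if x ≠ 0 then 1 else 0 : ℕ) : ZMod 2) = x := by decide
  exact eq_ite (D k i)
end

section
/- Permutation sign lemma for Case 2 (Appendix C). Let m ≥ 1 and let P be a finite set of positive integers with |P| = m + 1. For each k ∈ P let σ_k : {1,…,m} → P \ {k} be the increasing enumeration of P \ {k}, and let pos_P(k) denote the 1-indexed position of k in the increasing enumeration of P. Suppose k, k' ∈ P with k ≠ k', p ∈ {1,…,m}, and u, u' are permutations of {1,…,m} such that σ_k(u(p)) = k', σ_{k'}(u'(p)) = k, and σ_{k'}(u'(j)) = σ_k(u(j)) for all j ∈ {1,…,m} with j ≠ p. Then pos_P(k) + pos_P(k') + inv(u) + inv(u') is odd, where inv(v) := Σ_{i=1}^m |{j : i < j ≤ m, v(j) < v(i)}| denotes the number of inversions of a permutation v of {1,…,m}. Equivalently, (−1)^{−pos_P(k) − pos_P(k') + inv(u) + inv(u')} = −1. -/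
open Finset in
/-- The inversions of `f` that involve the index `p`, counted in terms of the rank of `f p`. -/
theorem card_inversions_add_card_lt {m : ℕ} (f : Fin m → ℕ) (hf : Function.Injective f)
    (p : Fin m) :
    #{ij : Fin m × Fin m | ij.1 < ij.2 ∧ f ij.2 < f ij.1} + #{j | f j < f p} =
      #{ij : Fin m × Fin m | (ij.1 ≠ p ∧ ij.2 ≠ p) ∧ ij.1 < ij.2 ∧ f ij.2 < f ij.1} +
        2 * #{j | p < j ∧ f j < f p} + p := by
  have hsplit : #{ij : Fin m × Fin m | ij.1 < ij.2 ∧ f ij.2 < f ij.1} =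
      #{ij : Fin m × Fin m | (ij.1 ≠ p ∧ ij.2 ≠ p) ∧ ij.1 < ij.2 ∧ f ij.2 < f ij.1} +
        (#{j | p < j ∧ f j < f p} + #{i | i < p ∧ f p < f i}) := by
    rw [← card_image_of_injective {j | p < j ∧ f j < f p} (Prod.mk_right_injective p),
      ← card_image_of_injective {i | i < p ∧ f p < f i} (Prod.mk_left_injective p),
      ← card_union_of_disjoint, ← card_union_of_disjoint]
    · congr 1
      ext ⟨i, j⟩
      simp only [mem_filter, mem_univ, true_and, mem_union, mem_image, Prod.mk.injEq]
      grind
    · simp only [disjoint_left, mem_filter, mem_univ, true_and, mem_union, mem_image]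
      grind
    · simp only [disjoint_left, mem_filter, mem_univ, true_and, mem_image]
      grind
  have hrank : #{j | f j < f p} =
      #{j | p < j ∧ f j < f p} + #{j | j < p ∧ f j < f p} := by
    rw [← card_union_of_disjoint]
    · congr 1
      ext j
      simp only [mem_filter, mem_univ, true_and, mem_union]
      grind
    · simp only [disjoint_left, mem_filter, mem_univ, true_and]
      grind
  have hbelow : #{i | i < p ∧ f p < f i} + #{j | j < p ∧ f j < f p} = (p : ℕ) := by
    rw [← card_union_of_disjoint]
    · rw [← Fin.card_Iio p]
      congr 1
      ext j
      have : f j = f p → j = p := fun h => hf h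
      simp only [mem_filter, mem_univ, true_and, mem_union, mem_Iio]
      grind
    · simp only [disjoint_left, mem_filter, mem_univ, true_and]
      grind
  omega

open Finset in
theorem card_filter_orderEmbOfFin_lt {s : Finset ℕ} {m : ℕ} (hs : #s = m)
    (v : Equiv.Perm (Fin m)) (a : ℕ) :
    #{j | s.orderEmbOfFin hs (v j) < a} = #{x ∈ s | x < a} := by
  rw [← card_image_of_injective _ ((s.orderEmbOfFin hs).injective.comp v.injective)]
  congr 1
  ext x
  have hx : x ∈ s ↔ ∃ j, s.orderEmbOfFin hs (v j) = x := by
    rw [← mem_coe, ← range_orderEmbOfFin s hs, Set.mem_range]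
    exact v.surjective.exists
  simp only [mem_filter, mem_univ, true_and, mem_image, Function.comp_apply, hx]
  grind

open Finset in
theorem card_filter_le_eq_card_erase_filter_lt {s : Finset ℕ} {a b : ℕ} (ha : a ∈ s)
    (hb : b ∈ s) :
    #{x ∈ s | x ≤ b} = #{x ∈ s.erase a | x < b} + 1 + if a < b then 1 else 0 := by
  have hle : {x ∈ s | x ≤ b} = insert b {x ∈ s | x < b} := by
    ext x
    simp only [mem_filter, mem_insert]
    grind
  rw [hle, card_insert_of_notMem (by simp), filter_erase]
  split_ifs with h
  · rw [← card_erase_add_one (mem_filter.2 ⟨ha, h⟩)]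
  · rw [erase_eq_of_notMem (by simp [h])]

/-- Permutation sign lemma for Case 2 (Appendix C): if `P` is a set of `m+1` positive
integers, `k ≠ k'` in `P`, and permutations `u, u'` of `{1,…,m}` are such that the
increasing enumerations `σ_k` of `P \ {k}` and `σ_{k'}` of `P \ {k'}` satisfy
`σ_k(u(p)) = k'`, `σ_{k'}(u'(p)) = k` and `σ_{k'}(u'(j)) = σ_k(u(j))` for `j ≠ p`, then
`pos_P(k) + pos_P(k') + inv(u) + inv(u')` is odd. -/
theorem case2_permutation_sign (m : ℕ) (hm : 1 ≤ m)
    (P : Finset ℕ) (hPpos : ∀ x ∈ P, 0 < x) (hP : P.card = m + 1)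
    (k k' : ℕ) (hk : k ∈ P) (hk' : k' ∈ P) (hkk' : k ≠ k')
    (p : Fin m) (u u' : Equiv.Perm (Fin m))
    (h1 : (P.erase k).orderEmbOfFin
        (by rw [Finset.card_erase_of_mem hk, hP]; omega) (u p) = k')
    (h2 : (P.erase k').orderEmbOfFin
        (by rw [Finset.card_erase_of_mem hk', hP]; omega) (u' p) = k)
    (h3 : ∀ j : Fin m, j ≠ p →
      (P.erase k').orderEmbOfFin
        (by rw [Finset.card_erase_of_mem hk', hP]; omega) (u' j) =
      (P.erase k).orderEmbOfFin
        (by rw [Finset.card_erase_of_mem hk, hP]; omega) (u j)) :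
    Odd ((P.filter (· ≤ k)).card + (P.filter (· ≤ k')).card +
      (Finset.univ.filter
        (fun ij : Fin m × Fin m => ij.1 < ij.2 ∧ u ij.2 < u ij.1)).card +
      (Finset.univ.filter
        (fun ij : Fin m × Fin m => ij.1 < ij.2 ∧ u' ij.2 < u' ij.1)).card) := by
  have hcard : (P.erase k).card = m := by rw [Finset.card_erase_of_mem hk, hP]; omega
  have hcard' : (P.erase k').card = m := by rw [Finset.card_erase_of_mem hk', hP]; omega
  have hu := card_inversions_add_card_lt _
    (((P.erase k).orderEmbOfFin hcard).injective.comp u.injective) p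
  have hu' := card_inversions_add_card_lt _
    (((P.erase k').orderEmbOfFin hcard').injective.comp u'.injective) p
  have hcommon : (Finset.univ.filter (fun ij : Fin m × Fin m => (ij.1 ≠ p ∧ ij.2 ≠ p) ∧
        ij.1 < ij.2 ∧ (P.erase k').orderEmbOfFin hcard' (u' ij.2) <
          (P.erase k').orderEmbOfFin hcard' (u' ij.1))) =
      Finset.univ.filter (fun ij : Fin m × Fin m => (ij.1 ≠ p ∧ ij.2 ≠ p) ∧
        ij.1 < ij.2 ∧ (P.erase k).orderEmbOfFin hcard (u ij.2) <
          (P.erase k).orderEmbOfFin hcard (u ij.1)) := by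
    refine Finset.filter_congr fun ij _ => and_congr_right fun h => ?_
    rw [h3 _ h.1, h3 _ h.2]
  simp only [Function.comp_apply] at hu hu'
  rw [hcommon] at hu'
  simp only [h1, h2, card_filter_orderEmbOfFin_lt, OrderEmbedding.lt_iff_lt] at hu hu'
  rw [card_filter_le_eq_card_erase_filter_lt hk' hk,
    card_filter_le_eq_card_erase_filter_lt hk hk', Nat.odd_iff]
  split_ifs <;> omega
end
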